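/- arXiv:2403.12148 — 2 statements merged into one kernel-verified Lean document; each statement's English description precedes it below -/
import Mathlib

section
/- Let c1, c2, c3, c4 be generic real numbers, N ≥ 0 an integer, and c0 = −2N−3−c1−c2−c3−c4. For all integers i, j, x, y ≥ 0 with i+j ≤ N and x+y ≤ N, the Griffiths polynomials of Racah type satisfy the difference equation ( μ_j(c_{04}) + (1/2)(c4+1)(c0+1) ) · G_{i,j}(x,y) = Σ over ε, ε' in {−1, 0, +1} of D^{ε',ε}(y,x; c3,c0,c4,c1) · G_{i,j}(x+ε, y+ε'), where D^{ε',ε}(y,x; c3,c0,c4,c1) denotes the nine-point difference coefficient formulas with parameters (c1,c2,c3,c4) replaced by (c3,c0,c4,c1) (so the associated fifth parameter is c2) and variables (x,y) replaced by (y,x). -/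
open Finset

noncomputable section

/-- Pochhammer symbol `(a)_k = a (a+1) ⋯ (a+k-1)`. -/
def poch (a : ℝ) (k : ℕ) : ℝ := ∏ i ∈ Finset.range k, (a + i)

/-- A real number is *generic* if it is not an integer. -/
def Generic (r : ℝ) : Prop := ∀ m : ℤ, r ≠ (m : ℝ)

/-- Genericity for three parameters: none of the parameters, nor any sum of two or three
of them, is an integer; this guarantees that no denominator vanishes. -/
def Generic3 (c1 c2 c3 : ℝ) : Prop :=
  Generic c1 ∧ Generic c2 ∧ Generic c3 ∧
  Generic (c1+c2) ∧ Generic (c1+c3) ∧ Generic (c2+c3) ∧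
  Generic (c1+c2+c3)

/-- Genericity for four parameters: none of the parameters, nor any sum of two, three or
four of them, is an integer; this guarantees that no denominator vanishes. -/
def Generic4 (c1 c2 c3 c4 : ℝ) : Prop :=
  Generic c1 ∧ Generic c2 ∧ Generic c3 ∧ Generic c4 ∧
  Generic (c1+c2) ∧ Generic (c1+c3) ∧ Generic (c1+c4) ∧
  Generic (c2+c3) ∧ Generic (c2+c4) ∧ Generic (c3+c4) ∧
  Generic (c1+c2+c3) ∧ Generic (c1+c2+c4) ∧ Generic (c1+c3+c4) ∧ Generic (c2+c3+c4) ∧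
  Generic (c1+c2+c3+c4)

/-- Normalization `Ω(n; c1,c2,c3; M)`. -/
def Om (n : ℤ) (c1 c2 c3 : ℝ) (M : ℤ) : ℝ :=
  (M.toNat.choose n.toNat : ℝ) * (2*(n:ℝ) + c2 + c3 + 1) *
    poch (c2+1) n.toNat * poch ((M:ℝ)+2+c1+c2+c3) n.toNat * poch (c1+1) (M-n).toNat /
    (poch (c3+1) n.toNat * poch (c2+c3+(n:ℝ)+1) (M.toNat+1))

/-- The renormalized Racah polynomial `p_n(x; c1,c2,c3; M)`, with the convention that it
vanishes unless `0 ≤ n ≤ M`. -/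
def racah (n : ℤ) (x : ℝ) (c1 c2 c3 : ℝ) (M : ℤ) : ℝ :=
  if 0 ≤ n ∧ n ≤ M then
    Om n c1 c2 c3 M *
      ∑ k ∈ Finset.range (n.toNat + 1),
        (poch (-(n:ℝ)) k * poch ((n:ℝ)+c2+c3+1) k * poch (-x) k * poch (x+c1+c2+1) k) /
        (poch (c2+1) k * poch ((M:ℝ)+2+c1+c2+c3) k * poch (-(M:ℝ)) k * (Nat.factorial k : ℝ))
  else 0

/-- Weight `Λ(x; c1,c2; M)`. -/
def Lam (x : ℤ) (c1 c2 : ℝ) (M : ℤ) : ℝ :=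
  (-1:ℝ)^x.toNat * (M.toNat.choose x.toNat : ℝ) * (2*(x:ℝ)+c1+c2+1) * poch (c2+1) x.toNat /
    (poch (c1+1) x.toNat * poch ((x:ℝ)+c1+c2+1) (M.toNat+1))

/-- `λ(x; c) = x(x+c+1)`. -/
def lam (x c : ℝ) : ℝ := x*(x+c+1)

/-- `μ_n(c) = n(n+c+1)`. -/
def mu (n c : ℝ) : ℝ := n*(n+c+1)

/-- Recurrence coefficient `A_n(c1,c2,c3; M)`. -/
def coefA (n c1 c2 c3 M : ℝ) : ℝ :=
  (n-M)*(n+c1+c2+c3+M+2)*(n+c2+1)*(n+c2+c3+1)/((2*n+c2+c3+1)*(2*n+c2+c3+2))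

/-- Recurrence coefficient `C_n(c1,c2,c3; M)`. -/
def coefC (n c1 c2 c3 M : ℝ) : ℝ :=
  n*(n-c1-M-1)*(n+c2+c3+M+1)*(n+c3)/((2*n+c2+c3)*(2*n+c2+c3+1))

/-- `Σ_n = A_n + C_n`. -/
def coefSig (n c1 c2 c3 M : ℝ) : ℝ := coefA n c1 c2 c3 M + coefC n c1 c2 c3 M

/-- Difference coefficient `B(x; c1,c2,c3; M)`. -/
def coefB (x c1 c2 c3 M : ℝ) : ℝ :=
  (x-M)*(x+c2+1)*(x+c1+c2+c3+M+2)*(x+c1+c2+1)/((2*x+c1+c2+1)*(2*x+c1+c2+2))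

/-- Difference coefficient `D(x; c1,c2,c3; M)`. -/
def coefD (x c1 c2 c3 M : ℝ) : ℝ :=
  x*(x+c1)*(x-c3-M-1)*(x+c1+c2+M+1)/((2*x+c1+c2)*(2*x+c1+c2+1))

/-- `S = B + D`. -/
def coefS (x c1 c2 c3 M : ℝ) : ℝ := coefB x c1 c2 c3 M + coefD x c1 c2 c3 M

/-- `F(x; c1,c2)`. -/
def Ffun (x c1 c2 : ℝ) : ℝ :=
  (x+c2+1)*(x+c1+c2+1)/((2*x+c1+c2+1)*(2*x+c1+c2+2))

/-- `λ⁺(x; c12; M) = (x+c12+M+2)(x−M−1)`. -/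
def lamP (x c12 M : ℝ) : ℝ := (x+c12+M+2)*(x-M-1)

/-- `A⁺_n(c2,c3; M)`. -/
def Ap (n c2 c3 M : ℝ) : ℝ := -(n-M-1)*(n-M)*Ffun n c3 c2

/-- `C⁺_n(c2,c3; M) = A⁺_{−n−c23−1}(c2,c3; M)`. -/
def Cp (n c2 c3 M : ℝ) : ℝ := Ap (-n-c2-c3-1) c2 c3 M

/-- `Σ⁺_n = A⁺_n + C⁺_n + (M+1)(M+1+c3)`. -/
def Sp (n c2 c3 M : ℝ) : ℝ := Ap n c2 c3 M + Cp n c2 c3 M + (M+1)*(M+1+c3)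

/-- `λ⁻(x; c123, c3; M) = (x+c123+M+1)(x−M−c3)`. -/
def lamM (x c123 c3 M : ℝ) : ℝ := (x+c123+M+1)*(x-M-c3)

/-- `A⁻_n(c1,c2,c3; M)`. -/
def Am (n c1 c2 c3 M : ℝ) : ℝ := -(n+c1+c2+c3+M+1)*(n+c1+c2+c3+M+2)*Ffun n c3 c2

/-- `C⁻_n(c1,c2,c3; M) = A⁻_{−n−c23−1}(c1,c2,c3; M)`. -/
def Cm (n c1 c2 c3 M : ℝ) : ℝ := Am (-n-c2-c3-1) c1 c2 c3 M

/-- `Σ⁻_n = A⁻_n + C⁻_n + (M+c12+1)(M+c123+1)`. -/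
def Sm (n c1 c2 c3 M : ℝ) : ℝ :=
  Am n c1 c2 c3 M + Cm n c1 c2 c3 M + (M+c1+c2+1)*(M+c1+c2+c3+1)

/-- `μ⁺_n(c123, c1; M) = (n+c123+M+2)(n−M−1−c1)`. -/
def muP (n c123 c1 M : ℝ) : ℝ := (n+c123+M+2)*(n-M-1-c1)

/-- `B⁺(x; c1,c2,c3; M)`. -/
def Bp (x c1 c2 c3 M : ℝ) : ℝ := -(x+c1+c2+c3+M+2)*(x+c1+c2+c3+M+3)*Ffun x c1 c2

/-- `D⁺(x; c1,c2,c3; M) = B⁺(−x−c12−1; c1,c2,c3; M)`. -/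
def Dp (x c1 c2 c3 M : ℝ) : ℝ := Bp (-x-c1-c2-1) c1 c2 c3 M

/-- `S⁺ = B⁺ + D⁺ + (c23+M+2)(c123+M+2)`. -/
def SpD (x c1 c2 c3 M : ℝ) : ℝ :=
  Bp x c1 c2 c3 M + Dp x c1 c2 c3 M + (c2+c3+M+2)*(c1+c2+c3+M+2)

/-- `μ⁻_n(c23; M) = (n−M)(n+c23+M+1)`. -/
def muM (n c23 M : ℝ) : ℝ := (n-M)*(n+c23+M+1)

/-- `B⁻(x; c1,c2; M)`. -/
def Bm (x c1 c2 M : ℝ) : ℝ := -(x-M)*(x-M+1)*Ffun x c1 c2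

/-- `D⁻(x; c1,c2; M) = B⁻(−x−c12−1; c1,c2; M)`. -/
def Dm (x c1 c2 M : ℝ) : ℝ := Bm (-x-c1-c2-1) c1 c2 M

/-- `S⁻ = B⁻ + D⁻ + M(c1+M)`. -/
def SmD (x c1 c2 M : ℝ) : ℝ := Bm x c1 c2 M + Dm x c1 c2 M + M*(c1+M)

/-- Nine-point recurrence coefficients `A^{e,e'}_{i,j}(c1,c2,c3,c4)` (with
`c0 = −2N−3−c1−c2−c3−c4`). -/
def nineA (e e' : ℤ) (i j : ℝ) (c1 c2 c3 c4 N : ℝ) : ℝ :=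
  let c0 : ℝ := -2*N-3-c1-c2-c3-c4
  if e = 1 ∧ e' = 1 then -(Ffun (-j-c0-c4-1) c4 c0) * Cm i c1 c2 c3 (N-j+1)
  else if e = 0 ∧ e' = 1 then (Ffun (-j-c0-c4-1) c4 c0) * Sm i c1 c2 c3 (N-j+1)
  else if e = -1 ∧ e' = 1 then -(Ffun (-j-c0-c4-1) c4 c0) * Am i c1 c2 c3 (N-j+1)
  else if e = 1 ∧ e' = -1 then -(Ffun j c4 c0) * Cp i c2 c3 (N-j-1)
  else if e = 0 ∧ e' = -1 then (Ffun j c4 c0) * Sp i c2 c3 (N-j-1)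
  else if e = -1 ∧ e' = -1 then -(Ffun j c4 c0) * Ap i c2 c3 (N-j-1)
  else if e = 1 ∧ e' = 0 then (Ffun j c4 c0 + Ffun (-j-c0-c4-1) c4 c0) * coefC i c1 c2 c3 (N-j)
  else if e = 0 ∧ e' = 0 then
    -(Ffun j c4 c0 + Ffun (-j-c0-c4-1) c4 c0) *
      (coefSig i c1 c2 c3 (N-j) + (N-j)^2 + (c1+c2+c3+2)*(N-j) + (1/2)*(c3+1)*(c1+c2+c3+1))
  else if e = -1 ∧ e' = 0 then (Ffun j c4 c0 + Ffun (-j-c0-c4-1) c4 c0) * coefA i c1 c2 c3 (N-j)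
  else 0

/-- `Γ^{0,0}_{i,j}(c1,c2,c3,c4)`. -/
def gam00 (i j : ℝ) (c1 c2 c3 c4 N : ℝ) : ℝ :=
  let c0 : ℝ := -2*N-3-c1-c2-c3-c4
  (-(coefSig i c1 c2 c3 (N-j)) + coefSig j c1 c0 c4 (N-i) - (1/4)*(c3^2-c4^2)
    + (i-N-(1/2)*(c4+1))*(i+(1/2)*(c2+c3-c0-c1))
    - (j-N-(1/2)*(c3+1))*(j+(1/2)*(c0+c4-c1-c2)))

/-- `Γ^{e,e'}_{i,j}` coefficients. -/
def gam (e e' : ℤ) (i j : ℝ) (c1 c2 c3 c4 N : ℝ) : ℝ :=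
  let c0 : ℝ := -2*N-3-c1-c2-c3-c4
  if e = 0 ∧ e' = 1 then coefC j c1 c0 c4 (N-i)
  else if e = 0 ∧ e' = -1 then coefA j c1 c0 c4 (N-i)
  else if e = 1 ∧ e' = 0 then coefC i c1 c2 c3 (N-j)
  else if e = -1 ∧ e' = 0 then coefA i c1 c2 c3 (N-j)
  else if e = 0 ∧ e' = 0 then gam00 i j c1 c2 c3 c4 N
  else 0

/-- Nine-point difference coefficients `D^{e,e'}(x,y; c1,c2,c3,c4)` (with
`c0 = −2N−3−c1−c2−c3−c4`). -/
def nineD (e e' : ℤ) (x y : ℝ) (c1 c2 c3 c4 N : ℝ) : ℝ :=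
  let c0 : ℝ := -2*N-3-c1-c2-c3-c4
  if e = 1 ∧ e' = 1 then -(Ffun x c1 c2) * Bm y c3 c0 (N-x)
  else if e = 1 ∧ e' = 0 then (Ffun x c1 c2) * SmD y c3 c0 (N-x)
  else if e = 1 ∧ e' = -1 then -(Ffun x c1 c2) * Dm y c3 c0 (N-x)
  else if e = -1 ∧ e' = 1 then -(Ffun (-x-c1-c2-1) c1 c2) * Bp y c3 c0 c4 (N-x)
  else if e = -1 ∧ e' = 0 then (Ffun (-x-c1-c2-1) c1 c2) * SpD y c3 c0 c4 (N-x)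
  else if e = -1 ∧ e' = -1 then -(Ffun (-x-c1-c2-1) c1 c2) * Dp y c3 c0 c4 (N-x)
  else if e = 0 ∧ e' = 1 then (Ffun x c1 c2 + Ffun (-x-c1-c2-1) c1 c2) * coefB y c3 c0 c4 (N-x)
  else if e = 0 ∧ e' = 0 then
    -(Ffun x c1 c2 + Ffun (-x-c1-c2-1) c1 c2) *
      (coefS y c3 c0 c4 (N-x) + (N-x)^2 + (c0+c3+c4+2)*(N-x) + (1/2)*(c3+1)*(c0+c3+c4+1))
  else if e = 0 ∧ e' = -1 then (Ffun x c1 c2 + Ffun (-x-c1-c2-1) c1 c2) * coefD y c3 c0 c4 (N-x)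
  else 0

/-- `Ψ^{a,b}(x,y)` coefficients: the first superscript refers to the shift in `y`,
the second to the shift in `x` (with `c0 = −2N−3−c1−c2−c3−c4`). -/
def psi (a b : ℤ) (x y : ℝ) (c1 c2 c3 c4 N : ℝ) : ℝ :=
  let c0 : ℝ := -2*N-3-c1-c2-c3-c4
  if a = 0 ∧ b = 1 then coefB x c4 c2 c1 (N-y)
  else if a = 0 ∧ b = -1 then coefD x c4 c2 c1 (N-y)
  else if a = 1 ∧ b = 0 then coefB y c3 c0 c1 (N-x)
  else if a = -1 ∧ b = 0 then coefD y c3 c0 c1 (N-x)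
  else if a = 0 ∧ b = 0 then gam00 x y c1 c2 c4 c3 N
  else 0

/-- Tratnik polynomial of Racah type `T_{i,j}(x,y; c1,c2,c3,c4; N)`, set to `0` outside
the triangular domains. -/
def trat (c1 c2 c3 c4 : ℝ) (Nn : ℕ) (i j x y : ℤ) : ℝ :=
  let c0 : ℝ := -2*(Nn:ℝ)-3-c1-c2-c3-c4
  if 0 ≤ i ∧ 0 ≤ j ∧ i + j ≤ (Nn:ℤ) ∧ 0 ≤ x ∧ 0 ≤ y ∧ x + y ≤ (Nn:ℤ) then
    racah i (x:ℝ) c1 c2 c3 ((Nn:ℤ)-j) * racah j (y:ℝ) c3 c0 c4 ((Nn:ℤ)-x)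
  else 0

/-- Griffiths polynomial of Racah type `G_{i,j}(x,y; c1,c2,c3,c4; N)`, set to `0` outside
the triangular domains. -/
def grif (c1 c2 c3 c4 : ℝ) (Nn : ℕ) (i j x y : ℤ) : ℝ :=
  let c0 : ℝ := -2*(Nn:ℝ)-3-c1-c2-c3-c4
  if 0 ≤ i ∧ 0 ≤ j ∧ i + j ≤ (Nn:ℤ) ∧ 0 ≤ x ∧ 0 ≤ y ∧ x + y ≤ (Nn:ℤ) then
    ∑ a ∈ Finset.range (((Nn:ℤ)-j).toNat + 1),
      (-1:ℝ)^a * racah i (a:ℝ) c1 c2 c3 ((Nn:ℤ)-j) * racah j (y:ℝ) c3 c0 c4 ((Nn:ℤ)-(a:ℤ)) *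
        racah (a:ℤ) (x:ℝ) c4 c2 c1 ((Nn:ℤ)-y)
  else 0

/-- Krawtchouk polynomial `K_n(x; p; M)`, set to `0` unless `0 ≤ n ≤ M`. -/
def kraw (n : ℤ) (x : ℝ) (p : ℝ) (M : ℤ) : ℝ :=
  if 0 ≤ n ∧ n ≤ M then
    (M.toNat.choose n.toNat : ℝ) * (p/(1-p))^n.toNat *
      ∑ k ∈ Finset.range (n.toNat + 1),
        poch (-(n:ℝ)) k * poch (-x) k / (poch (-(M:ℝ)) k * (Nat.factorial k : ℝ)) * (1/p)^k
  else 0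

theorem Generic.ne_zero {r z : ℝ} (h : Generic r) (m : ℤ) (hz : z = r + m) : z ≠ 0 := by
  intro h0
  apply h (-m)
  push_cast
  linarith

theorem Generic.of_eq_sub {r s : ℝ} (h : Generic r) (m : ℤ) (hs : s = m - r) : Generic s := by
  intro k hk
  apply h (m - k)
  push_cast
  linarith

@[simp] theorem poch_zero (a : ℝ) : poch a 0 = 1 := by simp [poch]

theorem poch_succ (a : ℝ) (k : ℕ) : poch a (k+1) = poch a k * (a + k) := by
  simp [poch, Finset.prod_range_succ]

theorem poch_succ' (a : ℝ) (k : ℕ) : poch a (k+1) = a * poch (a+1) k := by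
  simp only [poch, Finset.prod_range_succ']
  rw [mul_comm]
  congr 1
  · simp
  · exact Finset.prod_congr rfl fun i _ => by push_cast; ring

theorem poch_add_one_mul (a : ℝ) (k : ℕ) : a * poch (a+1) k = poch a k * (a + k) := by
  rw [← poch_succ', poch_succ]

theorem poch_ne_zero {a : ℝ} {k : ℕ} (h : ∀ i < k, a + i ≠ 0) : poch a k ≠ 0 :=
  Finset.prod_ne_zero_iff.2 fun i hi => h i (Finset.mem_range.1 hi)

theorem poch_neg_natCast_ne_zero {k M : ℕ} (h : k ≤ M) : poch (-(M:ℝ)) k ≠ 0 := by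
  refine poch_ne_zero fun i hi => ?_
  have : (i:ℝ) < M := by exact_mod_cast hi.trans_le h
  linarith

/-- The Racah basis `(-x)_k (x+s)_k`. -/
def racahBasis (s x : ℝ) (k : ℕ) : ℝ := poch (-x) k * poch (x+s) k

@[simp] theorem racahBasis_zero (s x : ℝ) : racahBasis s x 0 = 1 := by simp [racahBasis]

theorem racahBasis_succ (s x : ℝ) (k : ℕ) :
    racahBasis s x (k+1) = racahBasis s x k * ((k - x) * (x + s + k)) := by
  simp only [racahBasis, poch_succ]; ring

theorem racahBasis_add_one (s x : ℝ) (k : ℕ) :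
    (x+s) * racahBasis s (x+1) (k+1) =
      -(x+1) * (x+s+k) * (x+s+k+1) * racahBasis s x k := by
  have h1 : poch (-(x+1)) (k+1) = -(x+1) * poch (-x) k := by
    rw [poch_succ']; congr 2; ring
  have h2 : (x+s) * poch (x+1+s) (k+1) = poch (x+s) k * (x+s+k) * (x+s+k+1) := by
    have := poch_add_one_mul (x+s) (k+1)
    rw [poch_succ (x+s)] at this
    rw [show x+1+s = x+s+1 by ring, this]; push_cast; ring
  simp only [racahBasis]
  rw [h1]
  linear_combination (-(x+1) * poch (-x) k) * h2

theorem racahBasis_sub_one (s x : ℝ) (k : ℕ) :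
    -x * racahBasis s (x-1) (k+1) =
      (x+s-1) * (k-x) * (k+1-x) * racahBasis s x k := by
  have h1 : poch (x-1+s) (k+1) = (x+s-1) * poch (x+s) k := by
    rw [poch_succ', show x-1+s = x+s-1 by ring, show x+s-1+1 = x+s by ring]
  have h2 : -x * poch (-(x-1)) (k+1) = poch (-x) k * (k-x) * (k+1-x) := by
    have := poch_add_one_mul (-x) (k+1)
    rw [poch_succ (-x)] at this
    rw [show -(x-1) = -x+1 by ring, this]; push_cast; ring
  simp only [racahBasis]
  rw [h1]
  linear_combination ((x+s-1) * poch (x+s) k) * h2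

theorem Ffun_neg (x c1 c2 : ℝ) :
    Ffun (-x-c1-c2-1) c1 c2 = (x+c1)*x/((2*x+c1+c2+1)*(2*x+c1+c2)) := by
  rw [Ffun]
  congr 1 <;> ring

theorem Ffun_neg_zero (c1 c2 : ℝ) : Ffun (-0-c1-c2-1) c1 c2 = 0 := by
  rw [Ffun_neg, mul_zero, zero_div]

theorem Ffun_mul_racahBasis_sub {c1 c2 x : ℝ} (h1 : 2*x+c1+c2+1 ≠ 0) (h2 : 2*x+c1+c2+2 ≠ 0)
    (k : ℕ) :
    (2*x+c1+c2+1) *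
        (Ffun x c1 c2 * (racahBasis (c1+c2+1) (x+1) (k+1) - racahBasis (c1+c2+1) x (k+1))) =
      -(k+1) * (x+c2+1) * (x+c1+c2+1+k) * racahBasis (c1+c2+1) x k := by
  have h := racahBasis_add_one (c1+c2+1) x k
  rw [racahBasis_succ _ x, Ffun]
  generalize racahBasis (c1+c2+1) (x+1) (k+1) = R at *
  generalize racahBasis (c1+c2+1) x k = R' at *
  rw [div_mul_eq_mul_div, mul_div_assoc', div_eq_iff (mul_ne_zero h1 h2)]
  linear_combination (x+c2+1) * (2*x+c1+c2+1) * h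

theorem Ffun_neg_mul_racahBasis_sub {c1 c2 x : ℝ} (h0 : 2*x+c1+c2 ≠ 0) (h1 : 2*x+c1+c2+1 ≠ 0)
    (k : ℕ) :
    (2*x+c1+c2+1) *
        (Ffun (-x-c1-c2-1) c1 c2 *
          (racahBasis (c1+c2+1) (x-1) (k+1) - racahBasis (c1+c2+1) x (k+1))) =
      (k+1) * (x+c1) * (x-k) * racahBasis (c1+c2+1) x k := by
  have h := racahBasis_sub_one (c1+c2+1) x k
  rw [racahBasis_succ _ x, Ffun_neg]
  generalize racahBasis (c1+c2+1) (x-1) (k+1) = R at *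
  generalize racahBasis (c1+c2+1) x k = R' at *
  rw [div_mul_eq_mul_div, mul_div_assoc', div_eq_iff (mul_ne_zero h1 h0)]
  linear_combination (-(x+c1)) * (2*x+c1+c2+1) * h

/-- A second order operator with quadratic coefficient `q z² + p z + r` is two-term on the
Racah basis. -/
theorem quadratic_op_racahBasis {c1 c2 x : ℝ} (h0 : 2*x+c1+c2 ≠ 0) (h1 : 2*x+c1+c2+1 ≠ 0)
    (h2 : 2*x+c1+c2+2 ≠ 0) (q p r : ℝ) (k : ℕ) :
    (q*x^2+p*x+r) * Ffun x c1 c2 *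
        (racahBasis (c1+c2+1) (x+1) (k+1) - racahBasis (c1+c2+1) x (k+1)) +
      (q*(-x-c1-c2-1)^2+p*(-x-c1-c2-1)+r) * Ffun (-x-c1-c2-1) c1 c2 *
        (racahBasis (c1+c2+1) (x-1) (k+1) - racahBasis (c1+c2+1) x (k+1)) =
      (k+1) * (p+q*(k-c1)) * racahBasis (c1+c2+1) x (k+1) -
        (k+1) * (k+1+c2) * (q*k^2+p*k+r) * racahBasis (c1+c2+1) x k := by
  have e1 := Ffun_mul_racahBasis_sub h1 h2 k
  have e2 := Ffun_neg_mul_racahBasis_sub h0 h1 k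
  apply mul_left_cancel₀ h1
  have e3 := racahBasis_succ (c1+c2+1) x k
  linear_combination (q*x^2+p*x+r) * e1 + (q*(-x-c1-c2-1)^2+p*(-x-c1-c2-1)+r) * e2 -
    (2*x+c1+c2+1) * ((k+1) * (p+q*(k-c1))) * e3

/-- Coefficient of `racahBasis` in the renormalized Racah polynomial. -/
def racahCoeff (n : ℕ) (c1 c2 c3 : ℝ) (M : ℕ) (k : ℕ) : ℝ :=
  Om n c1 c2 c3 M *
    ((poch (-(n:ℝ)) k * poch ((n:ℝ)+c2+c3+1) k) /
      (poch (c2+1) k * poch ((M:ℝ)+2+c1+c2+c3) k * poch (-(M:ℝ)) k * (Nat.factorial k : ℝ)))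

theorem racah_eq_sum {n M : ℕ} (h : n ≤ M) (x c1 c2 c3 : ℝ) :
    racah n x c1 c2 c3 M =
      ∑ k ∈ Finset.range (n+1), racahCoeff n c1 c2 c3 M k * racahBasis (c1+c2+1) x k := by
  have h' : (0:ℤ) ≤ n ∧ (n:ℤ) ≤ M := ⟨by positivity, by exact_mod_cast h⟩
  rw [racah, if_pos h', Finset.mul_sum]
  refine Finset.sum_congr (by simp) fun k _ => ?_
  simp only [racahCoeff, racahBasis]
  rw [show x + (c1+c2+1) = x+c1+c2+1 by ring]
  push_cast
  ring

theorem racah_eq_zero {n M : ℤ} (h : M < n) (x c1 c2 c3 : ℝ) : racah n x c1 c2 c3 M = 0 :=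
  if_neg fun h' => by omega

theorem racahCoeff_succ {n k M : ℕ} {c1 c2 c3 : ℝ} (hk : k < M) (h2 : Generic c2)
    (h123 : Generic (c1+c2+c3)) :
    racahCoeff n c1 c2 c3 M (k+1) * ((k+1+c2) * (M+2+c1+c2+c3+k) * (k-M) * (k+1)) =
      racahCoeff n c1 c2 c3 M k * ((k-n) * (n+c2+c3+1+k)) := by
  have d1 : (k+1+c2:ℝ) ≠ 0 := h2.ne_zero (k+1) (by push_cast; ring)
  have d2 : (M+2+c1+c2+c3+k:ℝ) ≠ 0 := h123.ne_zero (M+2+k) (by push_cast; ring)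
  have d3 : (k-M:ℝ) ≠ 0 := by
    have : (k:ℝ) < M := by exact_mod_cast hk
    linarith
  have d4 : (k+1:ℝ) ≠ 0 := by positivity
  have e : (poch (-(n:ℝ)) (k+1) * poch ((n:ℝ)+c2+c3+1) (k+1)) /
      (poch (c2+1) (k+1) * poch ((M:ℝ)+2+c1+c2+c3) (k+1) * poch (-(M:ℝ)) (k+1) *
        (Nat.factorial (k+1) : ℝ)) =
      (poch (-(n:ℝ)) k * poch ((n:ℝ)+c2+c3+1) k) /
      (poch (c2+1) k * poch ((M:ℝ)+2+c1+c2+c3) k * poch (-(M:ℝ)) k * (Nat.factorial k : ℝ)) *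
      (((k-n) * (n+c2+c3+1+k)) / ((k+1+c2) * (M+2+c1+c2+c3+k) * (k-M) * (k+1))) := by
    rw [← mul_div_mul_comm]
    simp only [poch_succ, Nat.factorial_succ]
    push_cast
    congr 1 <;> ring
  rw [racahCoeff, racahCoeff, e]
  have d : ((k+1+c2) * (M+2+c1+c2+c3+k) * (k-M) * (k+1) : ℝ) ≠ 0 := by
    simp only [ne_eq, mul_eq_zero, not_or]; exact ⟨⟨⟨d1, d2⟩, d3⟩, d4⟩
  rw [mul_assoc, mul_assoc (_ / _) (_ / _), div_mul_cancel₀ _ d,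
    mul_assoc (Om _ _ _ _ _)]

theorem Om_shift {n M : ℕ} {c1 c2 c3 : ℝ} (hn : n ≤ M) (h3 : Generic c3)
    (h23 : Generic (c2+c3)) :
    Om n c1 c2 c3 (M+1 : ℕ) * ((M+1-n) * (M+2+c1+c2+c3) * (c2+c3+n+M+2)) =
      Om n c1 c2 c3 M * ((M+1) * (M+2+c1+c2+c3+n) * (c1+1+M-n)) := by
  have t1 : (((M+1:ℕ):ℤ) - (n:ℤ)).toNat = (M-n)+1 := by omega
  have t2 : ((M:ℤ) - (n:ℤ)).toNat = M-n := by omega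
  have hc : ((M.choose n : ℕ) : ℝ) * (M+1) = ((M+1).choose n : ℕ) * (M+1-n) := by
    have := Nat.choose_mul_succ_eq M n
    have h' : ((M + 1 - n : ℕ) : ℝ) = M+1-n := by
      rw [Nat.cast_sub (by omega)]; push_cast; ring
    rw [← h']; exact_mod_cast this
  have hp := poch_add_one_mul ((M:ℝ)+2+c1+c2+c3) n
  have hs : ((M-n:ℕ):ℝ) = M-n := Nat.cast_sub hn
  have d1 : poch (c3+1) n ≠ 0 :=
    poch_ne_zero fun i _ => h3.ne_zero (1+i) (by push_cast; ring)
  have d2 : poch (c2+c3+n+1) (M+1) ≠ 0 :=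
    poch_ne_zero fun i _ => h23.ne_zero (n+1+i) (by push_cast; ring)
  have d3 : c2+c3+n+M+2 ≠ 0 := h23.ne_zero (n+M+2) (by push_cast; ring)
  simp only [Om, t1, t2, Int.toNat_natCast, Int.cast_natCast]
  rw [poch_succ (c2+c3+n+1) (M+1), poch_succ (c1+1), hs]
  push_cast
  rw [show (c2+c3+n+1+(M+1):ℝ) = c2+c3+n+M+2 by ring,
    show ((M:ℝ)+1+2+c1+c2+c3) = M+2+c1+c2+c3+1 by ring]
  generalize poch ((M:ℝ)+2+c1+c2+c3+1) n = P at *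
  generalize poch ((M:ℝ)+2+c1+c2+c3) n = P' at *
  generalize poch (c3+1) n = p at *
  generalize poch (c2+c3+n+1) (M+1) = Q at *
  generalize poch (c2+1) n = q at *
  generalize poch (c1+1) (M-n) = r at *
  generalize ((M.choose n : ℕ) : ℝ) = C at *
  generalize (((M+1).choose n : ℕ) : ℝ) = C' at *
  rw [div_mul_eq_mul_div, div_mul_eq_mul_div,
    div_eq_div_iff (mul_ne_zero d1 (mul_ne_zero d2 d3)) (mul_ne_zero d1 d2)]
  linear_combination q*r*p*Q*(c2+c3+n+M+2)*(2*n+c2+c3+1) * (c1+1+M-n) *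
    (C' * (M+1-n) * hp - P' * (M+2+c1+c2+c3+n) * hc)

theorem racahCoeff_shift {n k M : ℕ} {c1 c2 c3 : ℝ} (hn : n ≤ M) (hk : k ≤ M)
    (h2 : Generic c2) (h3 : Generic c3)
    (h23 : Generic (c2+c3)) (h123 : Generic (c1+c2+c3)) :
    racahCoeff n c1 c2 c3 (M+1) k * ((M+1-n) * (c2+c3+n+M+2) * (M+2+c1+c2+c3+k)) =
      racahCoeff n c1 c2 c3 M k * ((M+2+c1+c2+c3+n) * (c1+1+M-n) * (M+1-k)) := by
  have hO := Om_shift (c1 := c1) hn h3 h23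
  have hp := poch_add_one_mul ((M:ℝ)+2+c1+c2+c3) k
  have hq := poch_add_one_mul (-((M:ℝ)+1)) k
  rw [show -((M:ℝ)+1)+1 = -M by ring] at hq
  have d1 : poch (c2+1) k ≠ 0 :=
    poch_ne_zero fun i _ => h2.ne_zero (1+i) (by push_cast; ring)
  have d2 : poch ((M:ℝ)+2+c1+c2+c3+1) k ≠ 0 :=
    poch_ne_zero fun i _ => h123.ne_zero (M+3+i) (by push_cast; ring)
  have d3 : poch ((M:ℝ)+2+c1+c2+c3) k ≠ 0 :=
    poch_ne_zero fun i _ => h123.ne_zero (M+2+i) (by push_cast; ring)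
  have d4 : poch (-(M:ℝ)) k ≠ 0 := poch_neg_natCast_ne_zero hk
  have d5 : poch (-((M:ℝ)+1)) k ≠ 0 := by
    have := poch_neg_natCast_ne_zero (k := k) (M := M+1) (by omega)
    push_cast at this; exact this
  have d6 : (Nat.factorial k : ℝ) ≠ 0 := by positivity
  have d7 : (M+2+c1+c2+c3:ℝ) ≠ 0 := h123.ne_zero (M+2) (by push_cast; ring)
  have d8 : (M+1:ℝ) ≠ 0 := by positivity
  simp only [racahCoeff]
  push_cast at hO ⊢
  rw [show ((M:ℝ)+1+2+c1+c2+c3) = M+2+c1+c2+c3+1 by ring]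
  generalize Om n c1 c2 c3 (M+1) = O1 at *
  generalize Om n c1 c2 c3 M = O0 at *
  generalize poch ((M:ℝ)+2+c1+c2+c3+1) k = P at *
  generalize poch ((M:ℝ)+2+c1+c2+c3) k = P' at *
  generalize poch (-((M:ℝ)+1)) k = R at *
  generalize poch (-(M:ℝ)) k = R' at *
  generalize poch (-(n:ℝ)) k = A at *
  generalize poch ((n:ℝ)+c2+c3+1) k = B at *
  generalize poch (c2+1) k = p at *
  rw [mul_div_assoc', mul_div_assoc', div_mul_eq_mul_div, div_mul_eq_mul_div,
    div_eq_div_iff (mul_ne_zero (mul_ne_zero (mul_ne_zero d1 d2) d5) d6)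
      (mul_ne_zero (mul_ne_zero (mul_ne_zero d1 d3) d4) d6)]
  apply mul_left_cancel₀ (mul_ne_zero d7 d8)
  generalize (Nat.factorial k : ℝ) = f at *
  linear_combination p*f*A*B*(M+2+c1+c2+c3+k)*P'*R'*(M+1) * hO -
    p*f*A*B*O0*(M+1)*(M+2+c1+c2+c3+n)*(c1+1+M-n)*((M+1)*R' * hp + (M+2+c1+c2+c3)*P * hq)

theorem sum_two_term {n : ℕ} {t w φ L α β : ℕ → ℝ} (h0 : L 0 = α 0 * φ 0)
    (hL : ∀ k, L (k+1) = α (k+1) * φ (k+1) + β k * φ k)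
    (ht : ∀ k < n, α k * t k + β k * t (k+1) = w k)
    (hn : (α n * t n - w n) * φ n = 0) :
    ∑ k ∈ Finset.range (n+1), t k * L k = ∑ k ∈ Finset.range (n+1), w k * φ k := by
  have e1 : ∑ k ∈ Finset.range (n+1), t k * L k =
      ∑ k ∈ Finset.range (n+1), t k * α k * φ k +
        ∑ k ∈ Finset.range n, t (k+1) * β k * φ k := by
    rw [Finset.sum_range_succ', Finset.sum_range_succ' (fun k => t k * α k * φ k), h0,
      add_right_comm, ← Finset.sum_add_distrib]
    congr 1
    · exact Finset.sum_congr rfl fun k _ => by rw [hL]; ring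
    · ring
  rw [e1, Finset.sum_range_succ, Finset.sum_range_succ, add_right_comm,
    ← Finset.sum_add_distrib]
  congr 1
  · exact Finset.sum_congr rfl fun k hk => by
      rw [← ht k (Finset.mem_range.1 hk)]; ring
  · linear_combination hn

theorem quadratic_op_racah {n M : ℕ} (hnM : n ≤ M) {c1 c2 c3 x : ℝ} (h0 : 2*x+c1+c2 ≠ 0)
    (h1 : 2*x+c1+c2+1 ≠ 0) (h2 : 2*x+c1+c2+2 ≠ 0) (q p r σ : ℝ) {B S D : ℝ}
    (hB : B = (q*x^2+p*x+r) * Ffun x c1 c2)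
    (hD : D = (q*(-x-c1-c2-1)^2+p*(-x-c1-c2-1)+r) * Ffun (-x-c1-c2-1) c1 c2)
    (hS : S = B + D + σ) {w : ℕ → ℝ}
    (ht : ∀ k < n, (k*(p+q*(k-1-c1)) - σ) * racahCoeff n c1 c2 c3 M k -
      (k+1)*(k+1+c2)*(q*k^2+p*k+r) * racahCoeff n c1 c2 c3 M (k+1) = w k)
    (hn : ((n*(p+q*(n-1-c1)) - σ) * racahCoeff n c1 c2 c3 M n - w n) *
      racahBasis (c1+c2+1) x n = 0) :
    B * racah n (x+1) c1 c2 c3 M - S * racah n x c1 c2 c3 M + D * racah n (x-1) c1 c2 c3 M =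
      ∑ k ∈ Finset.range (n+1), w k * racahBasis (c1+c2+1) x k := by
  rw [← sum_two_term (t := racahCoeff n c1 c2 c3 M)
    (L := fun k => B * racahBasis (c1+c2+1) (x+1) k - S * racahBasis (c1+c2+1) x k +
      D * racahBasis (c1+c2+1) (x-1) k)
    (α := fun k => k*(p+q*(k-1-c1)) - σ) (β := fun k => -((k+1)*(k+1+c2)*(q*k^2+p*k+r)))
    ?_ ?_ ?_ hn]
  · simp only [racah_eq_sum hnM, Finset.mul_sum, ← Finset.sum_add_distrib,
      ← Finset.sum_sub_distrib]
    exact Finset.sum_congr rfl fun k _ => by ring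
  · simp [hS]; ring
  · intro k
    have := quadratic_op_racahBasis h0 h1 h2 q p r k
    rw [← hB, ← hD] at this
    rw [hS]
    push_cast
    linear_combination this
  · intro k hk
    rw [← ht k hk]; ring

theorem racahBasis_eq_zero {n : ℕ} {x : ℤ} (h0 : 0 ≤ x) (hx : x < n) (s : ℝ) :
    racahBasis s x n = 0 := by
  lift x to ℕ using h0
  rw [racahBasis, poch, Finset.prod_eq_zero (i := x), zero_mul]
  · simpa using hx
  · simp

theorem Generic.two_mul_add_ne_zero {c1 c2 : ℝ} (h : Generic (c1+c2)) (x : ℤ) :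
    2*(x:ℝ)+c1+c2 ≠ 0 ∧ 2*(x:ℝ)+c1+c2+1 ≠ 0 ∧ 2*(x:ℝ)+c1+c2+2 ≠ 0 :=
  ⟨h.ne_zero (2*x) (by push_cast; ring), h.ne_zero (2*x+1) (by push_cast; ring),
    h.ne_zero (2*x+2) (by push_cast; ring)⟩

theorem coefD_eq_mul_Ffun (x c1 c2 c3 M : ℝ) :
    coefD x c1 c2 c3 M =
      (x-c3-M-1)*(x+c1+c2+M+1) * Ffun (-x-c1-c2-1) c1 c2 := by
  rw [coefD, Ffun_neg, mul_div_assoc']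
  congr 1 <;> ring

theorem coefB_eq_mul_Ffun (x c1 c2 c3 M : ℝ) :
    coefB x c1 c2 c3 M = (x-M)*(x+c1+c2+c3+M+2) * Ffun x c1 c2 := by
  rw [coefB, Ffun, mul_div_assoc']
  congr 1; ring

/-- Difference equation of the Racah polynomials. -/
theorem racah_difference {c1 c2 c3 : ℝ} (h : Generic3 c1 c2 c3) {n M : ℤ} (x : ℤ)
    (hn : 0 ≤ n) (hM : 0 ≤ M) :
    coefB x c1 c2 c3 M * racah n (x+1) c1 c2 c3 M - coefS x c1 c2 c3 M * racah n x c1 c2 c3 M +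
      coefD x c1 c2 c3 M * racah n (x-1) c1 c2 c3 M =
      mu n (c2+c3) * racah n x c1 c2 c3 M := by
  obtain ⟨-, g2, -, g12, -, -, g123⟩ := h
  lift n to ℕ using hn
  lift M to ℕ using hM
  obtain hnM | hnM := lt_or_ge M n
  · have : (M:ℤ) < n := by exact_mod_cast hnM
    simp [racah_eq_zero this]
  obtain ⟨h0, h1, h2⟩ := g12.two_mul_add_ne_zero x
  push_cast
  refine (quadratic_op_racah (c3 := c3) (w := fun k => mu n (c2+c3) * racahCoeff n c1 c2 c3 M k)
    hnM h0 h1 h2 1 (c1+c2+c3+2) (-M*(c1+c2+c3+M+2)) 0 ?_ ?_ ?_ ?_ ?_).trans ?_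
  · rw [coefB_eq_mul_Ffun]; ring
  · rw [coefD_eq_mul_Ffun]; ring
  · simp [coefS]
  · intro k hk
    have := racahCoeff_succ (n := n) (hk.trans_le hnM) g2 g123
    simp only [mu]
    linear_combination -this
  · simp only [mu]; ring
  · simp only [racah_eq_sum hnM, Finset.mul_sum, mul_assoc]

/-- Contiguity relation lowering `M`. -/
theorem racah_contiguity_sub_one {c1 c2 c3 : ℝ} (h : Generic3 c1 c2 c3) {n M : ℤ} (x : ℤ)
    (hn : 0 ≤ n) (hM : 0 ≤ M) :
    Bm x c1 c2 M * racah n (x+1) c1 c2 c3 (M-1) - SmD x c1 c2 M * racah n x c1 c2 c3 (M-1) +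
      Dm x c1 c2 M * racah n (x-1) c1 c2 c3 (M-1) =
      muM n (c2+c3) M * racah n x c1 c2 c3 M := by
  obtain ⟨-, g2, g3, g12, -, g23, g123⟩ := h
  obtain hnM | hnM := le_or_gt M n
  · rw [racah_eq_zero (by omega), racah_eq_zero (by omega), racah_eq_zero (by omega)]
    obtain rfl | hnM := hnM.eq_or_lt
    · simp [muM]
    · rw [racah_eq_zero hnM]; ring
  obtain ⟨m, rfl⟩ : ∃ m : ℕ, M = m + 1 := ⟨(M-1).toNat, by omega⟩
  lift n to ℕ using hn
  replace hnM : n ≤ m := by omega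
  obtain ⟨h0, h1, h2⟩ := g12.two_mul_add_ne_zero x
  rw [show ((m:ℤ)+1-1) = m by ring, show ((m:ℤ)+1) = (m+1:ℕ) by push_cast; ring,
    racah_eq_sum (show n ≤ m+1 by omega), Finset.mul_sum]
  simp only [← mul_assoc]
  push_cast
  have d : ∀ k : ℕ, (m+2+c1+c2+c3+k:ℝ) ≠ 0 := fun k =>
    g123.ne_zero (m+2+k) (by push_cast; ring)
  have key : ∀ k ≤ m, (m+2+c1+c2+c3+k) *
      (muM n (c2+c3) (m+1) * racahCoeff n c1 c2 c3 (m+1) k) =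
        -((m+2+c1+c2+c3+n) * (c1+1+m-n) * (m+1-k)) * racahCoeff n c1 c2 c3 m k := by
    intro k hk
    have := racahCoeff_shift (c1 := c1) hnM hk g2 g3 g23 g123
    simp only [muM]
    linear_combination -this
  refine quadratic_op_racah hnM h0 h1 h2 (-1) (2*m+1) (-(m+1)*m) ((m+1)*(c1+m+1)) ?_ ?_ ?_ ?_ ?_
  · rw [Bm]; ring
  · rw [Dm, Bm]; ring
  · rw [SmD]; ring
  · intro k hk
    have := racahCoeff_succ (n := n) (hk.trans_le hnM) g2 g123
    apply mul_left_cancel₀ (d k)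
    linear_combination -(m+1-k) * this - key k (by omega)
  · rw [mul_eq_zero]
    left
    apply mul_left_cancel₀ (d n)
    linear_combination -key n hnM

/-- Contiguity relation raising `M`. -/
theorem racah_contiguity_add_one {c1 c2 c3 : ℝ} (h : Generic3 c1 c2 c3) {n M x : ℤ}
    (hn : 0 ≤ n) (hx : 0 ≤ x) (hxM : x ≤ M) :
    Bp x c1 c2 c3 M * racah n (x+1) c1 c2 c3 (M+1) -
        SpD x c1 c2 c3 M * racah n x c1 c2 c3 (M+1) +
        Dp x c1 c2 c3 M * racah n (x-1) c1 c2 c3 (M+1) =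
      muP n (c1+c2+c3) c1 M * racah n x c1 c2 c3 M := by
  obtain ⟨g1, g2, g3, g12, -, g23, g123⟩ := h
  lift M to ℕ using hx.trans hxM
  lift n to ℕ using hn
  obtain hnM | hnM := lt_or_ge (M+1) n
  · have : ((M:ℤ)+1) < n := by exact_mod_cast hnM
    simp [racah_eq_zero this, racah_eq_zero (show (M:ℤ) < n by omega)]
  obtain ⟨h0, h1, h2⟩ := g12.two_mul_add_ne_zero x
  rw [show ((M:ℤ)+1) = (M+1:ℕ) by push_cast; ring]
  have op := fun w => quadratic_op_racah (c3 := c3) hnM h0 h1 h2 (-1) (-2*(c1+c2+c3+M+2)-1)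
    (-(c1+c2+c3+M+2)*(c1+c2+c3+M+3)) ((c2+c3+M+2)*(c1+c2+c3+M+2)) (w := w)
    (B := Bp x c1 c2 c3 M) (S := SpD x c1 c2 c3 M) (D := Dp x c1 c2 c3 M)
    (by rw [Bp]; ring) (by rw [Dp, Bp]; ring) (by rw [SpD])
  have succ := fun k (hk : k < M + 1) => racahCoeff_succ (n := n) (c1 := c1) (c3 := c3) hk g2 g123
  push_cast at succ
  obtain rfl | hnM' := hnM.eq_or_lt
  · rw [racah_eq_zero (n := (M+1:ℕ)) (M := M) (by push_cast; omega), mul_zero]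
    push_cast at op succ ⊢
    rw [op (fun _ => 0) ?_ ?_]
    · simp
    · intro k hk
      have d : (k-(M+1):ℝ) ≠ 0 := by
        have : (k:ℝ) < M+1 := by exact_mod_cast hk
        linarith
      apply mul_left_cancel₀ d
      linear_combination (M+2+c1+c2+c3+k) * succ k hk
    · rw [racahBasis_eq_zero hx (by push_cast; omega), mul_zero]
  · replace hnM' : n ≤ M := by omega
    rw [racah_eq_sum hnM', Finset.mul_sum]
    simp only [← mul_assoc]
    have d : ∀ k : ℕ, k ≤ n → (M+1-k:ℝ) ≠ 0 := by
      intro k hk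
      have : (k:ℝ) ≤ M := by exact_mod_cast hk.trans hnM'
      linarith
    have key : ∀ k ≤ M, (M+1-k) * (muP n (c1+c2+c3) c1 M * racahCoeff n c1 c2 c3 M k) =
        -((M+1-n) * (c2+c3+n+M+2) * (M+2+c1+c2+c3+k)) * racahCoeff n c1 c2 c3 (M+1) k := by
      intro k hk
      have := racahCoeff_shift (c1 := c1) hnM' hk g2 g3 g23 g123
      simp only [muP]
      linear_combination this
    refine op _ ?_ ?_
    · intro k hk
      apply mul_left_cancel₀ (d k hk.le)
      linear_combination -(M+2+c1+c2+c3+k) * succ k (by omega) - key k (by omega)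
    · rw [mul_eq_zero]
      left
      apply mul_left_cancel₀ (d n le_rfl)
      linear_combination -key n hnM'

theorem SmD_self {c1 c2 : ℝ} (h : Generic (c1+c2)) (M : ℤ) : SmD M c1 c2 M = 0 := by
  obtain ⟨h0, h1, -⟩ := h.two_mul_add_ne_zero M
  have e := div_mul_cancel₀ ((M+c1)*M) (mul_ne_zero h1 h0)
  rw [← Ffun_neg] at e
  rw [SmD, Dm, Bm, Bm]
  linear_combination -e

theorem Ffun_add_Ffun_neg_mul {y c0 c1 c2 c3 c4 N : ℝ} (a : ℝ) (hc2 : c2 = -2*N-3-c3-c0-c4-c1)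
    (h0 : 2*y+c3+c0 ≠ 0) (h1 : 2*y+c3+c0+1 ≠ 0) (h2 : 2*y+c3+c0+2 ≠ 0) :
    (Ffun y c3 c0 + Ffun (-y-c3-c0-1) c3 c0) *
        (mu a (c2+c1) - ((N-y)^2 + (c2+c4+c1+2)*(N-y) + (1/2)*(c4+1)*(c2+c4+c1+1))) =
      (1/2)*(c4+1)*(c0+1) - coefS y c3 c0 c4 (N-a) := by
  have e := div_mul_cancel₀ ((y+c3)*y) (mul_ne_zero h1 h0)
  have e' := div_mul_cancel₀ ((y+c0+1)*(y+c3+c0+1)) (mul_ne_zero h1 h2)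
  rw [← Ffun_neg] at e
  rw [← Ffun] at e'
  rw [coefS, coefB_eq_mul_Ffun, coefD_eq_mul_Ffun, mu]
  generalize Ffun (-y-c3-c0-1) c3 c0 = G at *
  generalize Ffun y c3 c0 = F at *
  subst hc2
  apply mul_left_cancel₀ (mul_ne_zero h0 (mul_ne_zero h1 h2))
  linear_combination
    (2*y+c3+c0) * (a*(a+(-2*N-3-c3-c0-c4-c1+c1)+1) - ((N-y)^2 +
      (-2*N-3-c3-c0-c4-c1+c4+c1+2)*(N-y) + (1/2)*(c4+1)*(-2*N-3-c3-c0-c4-c1+c4+c1+1)) +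
      (y-(N-a))*(y+c3+c0+c4+(N-a)+2)) * e' +
    (2*y+c3+c0+2) * (a*(a+(-2*N-3-c3-c0-c4-c1+c1)+1) - ((N-y)^2 +
      (-2*N-3-c3-c0-c4-c1+c4+c1+2)*(N-y) + (1/2)*(c4+1)*(-2*N-3-c3-c0-c4-c1+c4+c1+1)) +
      (y-c4-(N-a)-1)*(y+c3+c0+(N-a)+1)) * e

theorem sum_nineD_mul {c0 c1 c2 c3 c4 N : ℝ} (hc2 : -2*N-3-c3-c0-c4-c1 = c2) (x y : ℝ)
    (f : ℤ → ℤ → ℝ) :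
    ∑ e ∈ ({-1,0,1} : Finset ℤ), ∑ e' ∈ ({-1,0,1} : Finset ℤ),
        nineD e' e y x c3 c0 c4 c1 N * f e e' =
      -Ffun y c3 c0 * (Bm x c4 c2 (N-y) * f 1 1 - SmD x c4 c2 (N-y) * f 0 1 +
          Dm x c4 c2 (N-y) * f (-1) 1) -
        Ffun (-y-c3-c0-1) c3 c0 * (Bp x c4 c2 c1 (N-y) * f 1 (-1) -
          SpD x c4 c2 c1 (N-y) * f 0 (-1) + Dp x c4 c2 c1 (N-y) * f (-1) (-1)) +
        (Ffun y c3 c0 + Ffun (-y-c3-c0-1) c3 c0) *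
          (coefB x c4 c2 c1 (N-y) * f 1 0 -
            (coefS x c4 c2 c1 (N-y) + (N-y)^2 + (c2+c4+c1+2)*(N-y) +
              (1/2)*(c4+1)*(c2+c4+c1+1)) * f 0 0 +
            coefD x c4 c2 c1 (N-y) * f (-1) 0) := by
  simp only [nineD, hc2]
  simp
  ring

/-- The summation over the middle index `a` is compatible with the nine-point operator
term by term. -/
theorem racah_mul_racah_difference {c0 c1 c2 c3 c4 : ℝ} {N a j x y : ℤ}
    (hc2 : c2 = -2*N-3-c3-c0-c4-c1) (hQ : Generic3 c4 c2 c1) (hP : Generic3 c3 c0 c4)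
    (ha : 0 ≤ a) (hj : 0 ≤ j) (haN : a ≤ N) (hx : 0 ≤ x) (hxy : x + y ≤ N)
    {f : ℤ → ℤ → ℝ}
    (hf : ∀ e e' : ℤ, f e e' =
      racah j (y+e') c3 c0 c4 (N-a) * racah a (x+e) c4 c2 c1 (N-(y+e'))) :
    ∑ e ∈ ({-1,0,1} : Finset ℤ), ∑ e' ∈ ({-1,0,1} : Finset ℤ),
        nineD e' e y x c3 c0 c4 c1 N * f e e' =
      (mu j (c0+c4) + (1/2)*(c4+1)*(c0+1)) * f 0 0 := by
  have hm := racah_contiguity_sub_one hQ (M := N-y) x ha (by omega)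
  have hp := racah_contiguity_add_one hQ (M := N-y) (x := x) ha hx (by omega)
  have h0 := racah_difference hQ (M := N-y) x ha (by omega)
  have hy := racah_difference hP (M := N-a) y hj (by omega)
  obtain ⟨-, -, -, g30, -⟩ := id hP
  obtain ⟨d0, d1, d2⟩ := g30.two_mul_add_ne_zero y
  have key := Ffun_add_Ffun_neg_mul (a:ℝ) hc2 d0 d1 d2
  rw [sum_nineD_mul hc2.symm]
  simp only [hf]
  rw [show N-(y+1) = N-y-1 by ring, show N-(y+-1) = N-y+1 by ring, add_zero]
  push_cast at *
  simp only [add_zero, ← sub_eq_add_neg] at *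
  have eB : coefB y c3 c0 c4 (N-a) = -Ffun y c3 c0 * muM a (c2+c1) (N-y) := by
    rw [coefB_eq_mul_Ffun, muM, hc2]; ring
  have eD : coefD y c3 c0 c4 (N-a) =
      -Ffun (-y-c3-c0-1) c3 c0 * muP a (c4+c2+c1) c4 (N-y) := by
    rw [coefD_eq_mul_Ffun, muP, hc2]; ring
  rw [eB, eD] at hy
  linear_combination
    -Ffun y c3 c0 * racah j (y+1) c3 c0 c4 (N-a) * hm -
    Ffun (-y-c3-c0-1) c3 c0 * racah j (y-1) c3 c0 c4 (N-a) * hp +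
    (Ffun y c3 c0 + Ffun (-y-c3-c0-1) c3 c0) * racah j y c3 c0 c4 (N-a) * h0 +
    racah a x c4 c2 c1 (N-y) * hy +
    racah j y c3 c0 c4 (N-a) * racah a x c4 c2 c1 (N-y) * key

theorem Generic4.generic3_left {c1 c2 c3 c4 : ℝ} (h : Generic4 c1 c2 c3 c4) :
    Generic3 c4 c2 c1 := by
  obtain ⟨h1, h2, h3, h4, h12, h13, h14, h23, h24, h34, h123, h124, -⟩ := h
  refine ⟨h4, h2, h1, ?_, ?_, ?_, ?_⟩
  · rwa [add_comm]
  · rwa [add_comm]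
  · rwa [add_comm]
  · rwa [show c4+c2+c1 = c1+c2+c4 by ring]

theorem Generic4.generic3_right {c0 c1 c2 c3 c4 : ℝ} (h : Generic4 c1 c2 c3 c4) {m : ℤ}
    (hc0 : c0 = m-c1-c2-c3-c4) : Generic3 c3 c0 c4 := by
  obtain ⟨h1, h2, h3, h4, h12, h13, h14, h23, h24, h34, h123, h124, h134, h234, h1234⟩ := h
  exact ⟨h3, h1234.of_eq_sub m (by rw [hc0]; ring), h4, h124.of_eq_sub m (by rw [hc0]; ring), h34,
    h123.of_eq_sub m (by rw [hc0]; ring), h12.of_eq_sub m (by rw [hc0]; ring)⟩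

/-- The sum defining the Griffiths polynomials, without any restriction on the variables. -/
def grifSum (c0 c1 c2 c3 c4 : ℝ) (N i j x y : ℤ) : ℝ :=
  ∑ a ∈ Finset.range ((N-j).toNat + 1),
    (-1:ℝ)^a * racah i (a:ℝ) c1 c2 c3 (N-j) * racah j (y:ℝ) c3 c0 c4 (N-(a:ℤ)) *
      racah (a:ℤ) (x:ℝ) c4 c2 c1 (N-y)

theorem sum_nineD_mul_grifSum {c0 c1 c2 c3 c4 : ℝ} {N i j x y : ℤ}
    (hc2 : c2 = -2*N-3-c3-c0-c4-c1) (hQ : Generic3 c4 c2 c1) (hP : Generic3 c3 c0 c4)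
    (hj : 0 ≤ j) (hjN : j ≤ N) (hx : 0 ≤ x) (hxy : x + y ≤ N) :
    ∑ e ∈ ({-1,0,1} : Finset ℤ), ∑ e' ∈ ({-1,0,1} : Finset ℤ),
        nineD e' e y x c3 c0 c4 c1 N * grifSum c0 c1 c2 c3 c4 N i j (x+e) (y+e') =
      (mu j (c0+c4) + (1/2)*(c4+1)*(c0+1)) * grifSum c0 c1 c2 c3 c4 N i j x y := by
  simp only [grifSum, Finset.mul_sum]
  rw [Finset.sum_congr rfl fun e _ => Finset.sum_comm, Finset.sum_comm]
  refine Finset.sum_congr rfl fun a ha => ?_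
  have haN : (a:ℤ) ≤ N := by
    have := Finset.mem_range.1 ha
    omega
  have key := racah_mul_racah_difference hc2 hQ hP (Int.natCast_nonneg a) hj haN hx hxy
    fun _ _ => rfl
  refine Eq.trans ?_ ((congrArg ((-1:ℝ)^a * racah i (a:ℝ) c1 c2 c3 (N-j) * ·) key).trans ?_)
  · simp only [Finset.mul_sum]
    refine Finset.sum_congr rfl fun e _ => Finset.sum_congr rfl fun e' _ => ?_
    push_cast
    ring
  · simp only [Int.cast_zero, add_zero]
    ring

/-- The nine-point operator only involves values inside the triangle `x + y ≤ N`. -/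
theorem sum_nineD_mul_congr {c0 c1 c2 c3 c4 : ℝ} {N x y : ℤ}
    (hc2 : c2 = -2*N-3-c3-c0-c4-c1) (hQ : Generic3 c4 c2 c1)
    (hx : 0 ≤ x) (hy : 0 ≤ y) (hxy : x + y ≤ N) {f g : ℤ → ℤ → ℝ}
    (hfg : ∀ e e', 0 ≤ x + e → 0 ≤ y + e' → x + e + (y + e') ≤ N → f e e' = g e e') :
    ∑ e ∈ ({-1,0,1} : Finset ℤ), ∑ e' ∈ ({-1,0,1} : Finset ℤ),
        nineD e' e y x c3 c0 c4 c1 N * f e e' =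
      ∑ e ∈ ({-1,0,1} : Finset ℤ), ∑ e' ∈ ({-1,0,1} : Finset ℤ),
        nineD e' e y x c3 c0 c4 c1 N * g e e' := by
  rw [sum_nineD_mul hc2.symm, sum_nineD_mul hc2.symm]
  have e11 : Bm x c4 c2 (N-y) * f 1 1 = Bm x c4 c2 (N-y) * g 1 1 := by
    by_cases h : x + y + 2 ≤ N
    · rw [hfg] <;> omega
    obtain h | h : y = N - x ∨ y = N - x - 1 := by omega
    · simp [Bm, h]
    · rw [Bm, show (x:ℝ) - (N-y) + 1 = 0 by rw [h]; push_cast; ring]; ring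
  have e01 : SmD x c4 c2 (N-y) * f 0 1 = SmD x c4 c2 (N-y) * g 0 1 := by
    by_cases h : x + y + 1 ≤ N
    · rw [hfg] <;> omega
    have h : (N:ℝ) - y = x := by
      rw [show N = x + y by omega]; push_cast; ring
    rw [h, SmD_self hQ.2.2.2.1, zero_mul, zero_mul]
  have e10 : coefB x c4 c2 c1 (N-y) * f 1 0 = coefB x c4 c2 c1 (N-y) * g 1 0 := by
    by_cases h : x + y + 1 ≤ N
    · rw [hfg] <;> omega
    have h : y = N - x := by omega
    simp [coefB, h]
  have em1 : Dm x c4 c2 (N-y) * f (-1) 1 = Dm x c4 c2 (N-y) * g (-1) 1 := by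
    obtain rfl | h := hx.eq_or_lt
    · rw [Dm, Bm, Int.cast_zero, Ffun_neg_zero]; ring
    · rw [hfg] <;> omega
  have em0 : coefD x c4 c2 c1 (N-y) * f (-1) 0 = coefD x c4 c2 c1 (N-y) * g (-1) 0 := by
    obtain rfl | h := hx.eq_or_lt
    · rw [coefD, Int.cast_zero]; ring
    · rw [hfg] <;> omega
  have e00 : f 0 0 = g 0 0 := hfg _ _ (by omega) (by omega) (by omega)
  rw [e11, e01, e10, em1, em0, e00]
  obtain rfl | h := hy.eq_or_lt
  · rw [Int.cast_zero, Ffun_neg_zero]; ring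
  have emm : Dp x c4 c2 c1 (N-y) * f (-1) (-1) = Dp x c4 c2 c1 (N-y) * g (-1) (-1) := by
    obtain rfl | h := hx.eq_or_lt
    · rw [Dp, Bp, Int.cast_zero, Ffun_neg_zero]; ring
    · rw [hfg] <;> omega
  rw [emm, hfg 1 (-1) (by omega) (by omega) (by omega),
    hfg 0 (-1) (by omega) (by omega) (by omega)]

/-- first difference equation for the Griffiths polynomials of Racah
type. -/
theorem griffiths_difference_j
    (Nn : ℕ) (c1 c2 c3 c4 : ℝ) (hgen : Generic4 c1 c2 c3 c4)
    (c0 : ℝ) (hc0 : c0 = -2*(Nn:ℝ)-3-c1-c2-c3-c4)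
    (i j x y : ℤ) (hi : 0 ≤ i) (hj : 0 ≤ j) (hij : i + j ≤ (Nn:ℤ))
    (hx : 0 ≤ x) (hy : 0 ≤ y) (hxy : x + y ≤ (Nn:ℤ)) :
    (mu (j:ℝ) (c0+c4) + (1/2)*(c4+1)*(c0+1)) * grif c1 c2 c3 c4 Nn i j x y =
      ∑ e ∈ ({-1,0,1} : Finset ℤ), ∑ e' ∈ ({-1,0,1} : Finset ℤ),
        nineD e' e (y:ℝ) (x:ℝ) c3 c0 c4 c1 (Nn:ℝ) *
          grif c1 c2 c3 c4 Nn i j (x+e) (y+e') := by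
  have hc0' : c0 = ((-2*(Nn:ℤ)-3 : ℤ):ℝ)-c1-c2-c3-c4 := by rw [hc0]; push_cast; ring
  have hc2 : c2 = -2*((Nn:ℤ):ℝ)-3-c3-c0-c4-c1 := by rw [hc0]; push_cast; ring
  have hgrif : ∀ x y : ℤ, 0 ≤ x → 0 ≤ y → x + y ≤ Nn →
      grif c1 c2 c3 c4 Nn i j x y = grifSum c0 c1 c2 c3 c4 Nn i j x y := by
    intro x y hx hy hxy
    simp only [grif, grifSum, ← hc0]
    exact if_pos ⟨hi, hj, hij, hx, hy, hxy⟩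
  have key := sum_nineD_mul_grifSum (i := i) hc2 hgen.generic3_left
    (hgen.generic3_right hc0') hj (by omega) hx hxy
  rw [← sum_nineD_mul_congr hc2 hgen.generic3_left hx hy hxy
    (f := fun e e' => grif c1 c2 c3 c4 Nn i j (x+e) (y+e'))
    fun e e' h1 h2 h3 => hgrif _ _ h1 h2 h3] at key
  rw [hgrif x y hx hy hxy, ← key]
  simp only [Int.cast_natCast]
end
end

section
/- Let N ≥ 0 be an integer and let σ1, σ2, σ3, σ4 be real numbers with σ0 = −σ1−σ2−σ3−σ4, assumed generic so that for all sufficiently large t no denominator occurring in the Griffiths polynomials with parameters (tσ1, tσ2, tσ3, tσ4) vanishes, and so that σ3 ≠ 0, σ0+σ4 ≠ 0, σ1+σ2 ≠ 0, σ2+σ3 ≠ 0, σ4+σ2 ≠ 0, σ2+σ1 ≠ 0, σ3+σ0 ≠ 0, σ0+σ4 ≠ 0, and each p_{lmn} below lies outside {0,1}. Then for all integers i, j, x, y ≥ 0 with i+j ≤ N and x+y ≤ N, the limit as t → ∞ of G_{i,j}(x,y; tσ1, tσ2, tσ3, tσ4; N) equals (σ1/(σ2+σ3))^{N−j} · (σ3/(σ0+σ4))^{N}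 · (σ4/(σ1+σ2))^{N−y} · Σ_{a=0}^{N−j} ( −(σ0+σ4)/σ3 )^a · K_i(a; p_{123}; N−j) · K_j(y; p_{304}; N−a) · K_a(x; p_{421}; N−y), where p_{lmn} = σ_m(σ_l+σ_m+σ_n) / [ (σ_l+σ_m)(σ_m+σ_n) ]. -/
open Finset

noncomputable section

/-- Genericity of the slopes `σ`: no subset sum of the parameters vanishes, so that
for all sufficiently large `t` no denominator occurring in the Griffiths polynomials
with parameters `(tσ1, tσ2, tσ3, tσ4)` vanishes. -/
def Slopes4 (s1 s2 s3 s4 : ℝ) : Prop :=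
  s1 ≠ 0 ∧ s2 ≠ 0 ∧ s3 ≠ 0 ∧ s4 ≠ 0 ∧
  s1+s2 ≠ 0 ∧ s1+s3 ≠ 0 ∧ s1+s4 ≠ 0 ∧ s2+s3 ≠ 0 ∧ s2+s4 ≠ 0 ∧ s3+s4 ≠ 0 ∧
  s1+s2+s3 ≠ 0 ∧ s1+s2+s4 ≠ 0 ∧ s1+s3+s4 ≠ 0 ∧ s2+s3+s4 ≠ 0 ∧
  s1+s2+s3+s4 ≠ 0

/-- `f t ∼ a t ^ k` as `t → ∞`, in the weak sense that `f t / t ^ k → a`. -/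
def HasLeading (f : ℝ → ℝ) (k : ℕ) (a : ℝ) : Prop :=
  Filter.Tendsto (fun t => f t / t ^ k) Filter.atTop (nhds a)

namespace HasLeading

variable {f g : ℝ → ℝ} {k l : ℕ} {a b : ℝ}

lemma const (c : ℝ) : HasLeading (fun _ => c) 0 c := by
  simp [HasLeading]

lemma const_one (c : ℝ) : HasLeading (fun _ => c) 1 0 := by
  simpa [HasLeading] using Filter.tendsto_id.const_div_atTop c

lemma mul_const (s : ℝ) : HasLeading (fun t => t * s) 1 s := by
  refine tendsto_const_nhds.congr' ?_
  filter_upwards [Filter.eventually_ne_atTop 0] with t ht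
  field_simp

lemma add (hf : HasLeading f k a) (hg : HasLeading g k b) :
    HasLeading (fun t => f t + g t) k (a + b) := by
  simpa only [HasLeading, add_div] using Filter.Tendsto.add hf hg

lemma add_const (hf : HasLeading f 1 a) (c : ℝ) : HasLeading (fun t => f t + c) 1 a := by
  simpa using hf.add (const_one c)

lemma const_add (hf : HasLeading f 1 a) (c : ℝ) : HasLeading (fun t => c + f t) 1 a := by
  simpa using (const_one c).add hf

lemma mul (hf : HasLeading f k a) (hg : HasLeading g l b) :
    HasLeading (fun t => f t * g t) (k + l) (a * b) := by
  simpa only [HasLeading, pow_add, mul_div_mul_comm] using Filter.Tendsto.mul hf hg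

lemma poch (hf : HasLeading f 1 a) (n : ℕ) : HasLeading (fun t => poch (f t) n) n (a ^ n) := by
  have h := tendsto_finsetProd (Finset.range n) fun i _ => hf.add_const (i : ℝ)
  simpa [HasLeading, _root_.poch, Finset.prod_div_distrib] using h

lemma tendsto_div (hf : HasLeading f k a) (hg : HasLeading g k b) (hb : b ≠ 0) :
    Filter.Tendsto (fun t => f t / g t) Filter.atTop (nhds (a / b)) := by
  refine (Filter.Tendsto.div hf hg hb).congr' ?_
  filter_upwards [Filter.eventually_ne_atTop 0] with t ht
  exact div_div_div_cancel_right₀ (pow_ne_zero k ht) _ _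

end HasLeading

section RacahLimit

variable {c1 c2 c3 : ℝ → ℝ} {s1 s2 s3 : ℝ}

lemma tendsto_Om (h1 : HasLeading c1 1 s1) (h2 : HasLeading c2 1 s2) (h3 : HasLeading c3 1 s3)
    (hs3 : s3 ≠ 0) (h23 : s2 + s3 ≠ 0) (n d : ℕ) :
    Filter.Tendsto (fun t => Om (n : ℤ) (c1 t) (c2 t) (c3 t) ((n + d : ℕ) : ℤ)) Filter.atTop
      (nhds (((n + d).choose n : ℝ) * (s2 + s3) * s2 ^ n * (s1 + s2 + s3) ^ n * s1 ^ d /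
        (s3 ^ n * (s2 + s3) ^ (n + d + 1)))) := by
  have hd : ((n + d : ℕ) - (n : ℤ)).toNat = d := by omega
  simp only [Om, Int.toNat_natCast, hd, Int.cast_natCast]
  refine HasLeading.tendsto_div (k := n + (n + d + 1)) ?_ ?_ (by positivity)
  · have := (((((HasLeading.const ((n + d).choose n : ℝ)).mul
      (((h2.const_add (2 * n)).add h3).add_const 1)).mul ((h2.add_const 1).poch n)).mul
      ((((h1.const_add ((n + d : ℕ) + 2)).add h2).add h3).poch n)).mul
      ((h1.add_const 1).poch d))
    convert this using 1
    ring
  · exact ((h3.add_const 1).poch n).mul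
      ((((h2.add h3).add_const n).add_const 1).poch (n + d + 1))

lemma tendsto_racah (h1 : HasLeading c1 1 s1) (h2 : HasLeading c2 1 s2)
    (h3 : HasLeading c3 1 s3) (hs1 : s1 ≠ 0) (hs2 : s2 ≠ 0) (hs3 : s3 ≠ 0)
    (h12 : s1 + s2 ≠ 0) (h23 : s2 + s3 ≠ 0) (h123 : s1 + s2 + s3 ≠ 0) {p : ℝ}
    (hp : p = s2 * (s1 + s2 + s3) / ((s1 + s2) * (s2 + s3))) (n : ℤ) (x : ℝ) (M : ℤ) :
    Filter.Tendsto (fun t => racah n x (c1 t) (c2 t) (c3 t) M) Filter.atTop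
      (nhds ((s1 / (s2 + s3)) ^ M.toNat * kraw n x p M)) := by
  unfold racah kraw
  split_ifs with hnM
  swap
  · simp
  obtain ⟨hn, hM⟩ := hnM
  lift n to ℕ using hn
  obtain ⟨d, rfl⟩ : ∃ d : ℕ, M = ((n + d : ℕ) : ℤ) := ⟨(M - n).toNat, by omega⟩
  simp only [Int.toNat_natCast, Int.cast_natCast]
  have hratio : p / (1 - p) = s2 * (s1 + s2 + s3) / (s1 * s3) := by
    have : 1 - p = s1 * s3 / ((s1 + s2) * (s2 + s3)) := by
      rw [hp]; field_simp; ring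
    rw [this, hp]; field_simp
  have hOm := tendsto_Om h1 h2 h3 hs3 h23 n d
  have hterm : ∀ k ∈ Finset.range (n + 1), Filter.Tendsto (fun t =>
      (poch (-(n : ℝ)) k * poch ((n : ℝ) + c2 t + c3 t + 1) k * poch (-x) k *
        poch (x + c1 t + c2 t + 1) k) /
      (poch (c2 t + 1) k * poch (((n + d : ℕ) : ℝ) + 2 + c1 t + c2 t + c3 t) k *
        poch (-((n + d : ℕ) : ℝ)) k * (Nat.factorial k : ℝ))) Filter.atTop
      (nhds (poch (-(n : ℝ)) k * poch (-x) k /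
        (poch (-((n + d : ℕ) : ℝ)) k * (Nat.factorial k : ℝ)) * (1 / p) ^ k)) := by
    intro k _
    have hnum := ((((h2.const_add n).add h3).add_const 1).poch k).mul
      ((((h1.const_add x).add h2).add_const 1).poch k)
    have hden := ((h2.add_const 1).poch k).mul
      ((((h1.const_add (((n + d : ℕ) : ℝ) + 2)).add h2).add h3).poch k)
    have h := (hnum.tendsto_div hden (by positivity)).const_mul
      (poch (-(n : ℝ)) k * poch (-x) k / (poch (-((n + d : ℕ) : ℝ)) k * (Nat.factorial k : ℝ)))
    have hlim : (s2 + s3) ^ k * (s1 + s2) ^ k / (s2 ^ k * (s1 + s2 + s3) ^ k) = (1 / p) ^ k := by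
      rw [hp, ← mul_pow, ← mul_pow, ← div_pow, one_div_div, mul_comm (s2 + s3)]
    rw [hlim] at h
    refine h.congr fun t => ?_
    rw [← mul_div_mul_comm]
    congr 1 <;> ring
  convert hOm.mul (tendsto_finsetSum _ hterm) using 2
  rw [hratio, ← mul_assoc]
  congr 1
  simp only [div_pow, mul_pow, pow_add, pow_one]
  field_simp

end RacahLimit

/-- limit of the Griffiths polynomials of Racah type towards the
Griffiths polynomials of Krawtchouk type. -/
theorem griffiths_krawtchouk_limit
    (Nn : ℕ) (σ0 σ1 σ2 σ3 σ4 : ℝ) (hσ0 : σ0 = -σ1-σ2-σ3-σ4)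
    (hgen : Slopes4 σ1 σ2 σ3 σ4)
    (h3 : σ3 ≠ 0) (h04 : σ0+σ4 ≠ 0) (h12 : σ1+σ2 ≠ 0) (h23 : σ2+σ3 ≠ 0)
    (h42 : σ4+σ2 ≠ 0) (h21 : σ2+σ1 ≠ 0) (h30 : σ3+σ0 ≠ 0)
    (p123 p304 p421 : ℝ)
    (hp123 : p123 = σ2*(σ1+σ2+σ3)/((σ1+σ2)*(σ2+σ3)))
    (hp304 : p304 = σ0*(σ3+σ0+σ4)/((σ3+σ0)*(σ0+σ4)))
    (hp421 : p421 = σ2*(σ4+σ2+σ1)/((σ4+σ2)*(σ2+σ1)))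
    (hp123' : p123 ≠ 0 ∧ p123 ≠ 1) (hp304' : p304 ≠ 0 ∧ p304 ≠ 1)
    (hp421' : p421 ≠ 0 ∧ p421 ≠ 1)
    (i j x y : ℤ) (hi : 0 ≤ i) (hj : 0 ≤ j) (hij : i + j ≤ (Nn:ℤ))
    (hx : 0 ≤ x) (hy : 0 ≤ y) (hxy : x + y ≤ (Nn:ℤ)) :
    Filter.Tendsto (fun t : ℝ => grif (t*σ1) (t*σ2) (t*σ3) (t*σ4) Nn i j x y)
      Filter.atTop
      (nhds ((σ1/(σ2+σ3))^(Nn - j.toNat) * (σ3/(σ0+σ4))^Nn * (σ4/(σ1+σ2))^(Nn - y.toNat) *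
        ∑ a ∈ Finset.range ((Nn - j.toNat) + 1),
          (-(σ0+σ4)/σ3)^a * kraw i (a:ℝ) p123 ((Nn:ℤ)-j) *
            kraw j (y:ℝ) p304 ((Nn:ℤ)-(a:ℤ)) * kraw (a:ℤ) (x:ℝ) p421 ((Nn:ℤ)-y))) := by
  obtain ⟨hs1, hs2, -, hs4, -, -, -, -, -, -, h123, h124, -, -, h1234⟩ := hgen
  have hL := HasLeading.mul_const
  have hL0 : HasLeading (fun t => -2 * (Nn : ℝ) - 3 - t * σ1 - t * σ2 - t * σ3 - t * σ4) 1 σ0 := by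
    convert (hL σ0).const_add (-2 * (Nn : ℝ) - 3) using 2 with t
    rw [hσ0]; ring
  have hs0 : σ0 ≠ 0 := fun h => h1234 (by linarith)
  have h304 : σ3 + σ0 + σ4 ≠ 0 := fun h => h12 (by linarith)
  have h421 : σ4 + σ2 + σ1 ≠ 0 := fun h => h124 (by linarith)
  have hdom : 0 ≤ i ∧ 0 ≤ j ∧ i + j ≤ (Nn : ℤ) ∧ 0 ≤ x ∧ 0 ≤ y ∧ x + y ≤ (Nn : ℤ) :=
    ⟨hi, hj, hij, hx, hy, hxy⟩
  have hNj : ((Nn : ℤ) - j).toNat = Nn - j.toNat := by omega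
  have hNy : ((Nn : ℤ) - y).toNat = Nn - y.toNat := by omega
  simp only [grif, if_pos hdom, hNj]
  rw [Finset.mul_sum]
  refine tendsto_finsetSum _ fun a ha => ?_
  have haN : a ≤ Nn := by
    have := Finset.mem_range.mp ha
    omega
  have hNa : ((Nn : ℤ) - (a : ℤ)).toNat = Nn - a := by omega
  have hi_lim := tendsto_racah (hL σ1) (hL σ2) (hL σ3) hs1 hs2 h3 h12 h23 h123 hp123
    i (a : ℝ) ((Nn : ℤ) - j)
  have hj_lim := tendsto_racah (hL σ3) hL0 (hL σ4) h3 hs0 hs4 h30 h04 h304 hp304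
    j (y : ℝ) ((Nn : ℤ) - (a : ℤ))
  have ha_lim := tendsto_racah (hL σ4) (hL σ2) (hL σ1) hs4 hs2 hs1 h42 h21 h421 hp421
    (a : ℤ) (x : ℝ) ((Nn : ℤ) - y)
  rw [hNj] at hi_lim
  rw [hNa] at hj_lim
  rw [hNy, add_comm σ2 σ1] at ha_lim
  convert ((hi_lim.const_mul ((-1 : ℝ) ^ a)).mul hj_lim).mul ha_lim using 2
  have hpow : (σ3 / (σ0 + σ4)) ^ Nn * (-(σ0 + σ4) / σ3) ^ a =
      (-1) ^ a * (σ3 / (σ0 + σ4)) ^ (Nn - a) := by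
    have hinv : -(σ0 + σ4) / σ3 = -1 * (σ3 / (σ0 + σ4))⁻¹ := by
      rw [inv_div]; ring
    rw [pow_sub₀ _ (div_ne_zero h3 h04) haN, hinv, mul_pow, inv_pow]
    ring
  linear_combination (σ1 / (σ2 + σ3)) ^ (Nn - j.toNat) * (σ4 / (σ1 + σ2)) ^ (Nn - y.toNat) *
    kraw i a p123 (Nn - j) * kraw j y p304 (Nn - a) * kraw a x p421 (Nn - y) * hpow
end
end
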